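/- Let X ∈ ℝ^{d0×n} and Y ∈ ℝ^{dh×n} be arbitrary. Every non-degenerate local minimum W̄ = (W̄_h, …, W̄_1), with W̄ᵢ ∈ ℝ^{dᵢ×d_{i−1}} and rank(W̄_h···W̄_1) = min over 0 ≤ i ≤ h of dᵢ, of the deep linear network objective f(W) = (1/2)·‖W_h···W_1·X − Y‖² is a global minimum of f. -/

import Mathlib

open Matrix

/-- Frobenius norm of a real matrix. -/
noncomputable def frob {m n : ℕ} (A : Matrix (Fin m) (Fin n) ℝ) : ℝ :=
  Real.sqrt (∑ i, ∑ j, (A i j) ^ 2)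

/-- The product of the first `p` layer matrices: `chainProd d W p = W_{p-1} ⋯ W_1 W_0`
(so the paper's `W_i` is `W (i-1)` here, and `chainProd d W h = W_h ⋯ W_1` of the paper). -/
noncomputable def chainProd (d : ℕ → ℕ)
    (W : (i : ℕ) → Matrix (Fin (d (i + 1))) (Fin (d i)) ℝ) :
    (p : ℕ) → Matrix (Fin (d p)) (Fin (d 0)) ℝ
  | 0 => 1
  | (p + 1) => W p * chainProd d W p

namespace Matrix

/-- The Frobenius inner product of two real matrices. -/
def frobInner {ι κ : Type*} [Fintype ι] [Fintype κ] (A B : Matrix ι κ ℝ) : ℝ :=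
  (Aᵀ * B).trace

section frobInner

variable {ι κ μ : Type*} [Fintype ι] [Fintype κ] [Fintype μ]

theorem frobInner_eq_sum (A B : Matrix ι κ ℝ) : frobInner A B = ∑ j, ∑ i, A i j * B i j := by
  simp [frobInner, trace, mul_apply]

theorem frobInner_comm (A B : Matrix ι κ ℝ) : frobInner A B = frobInner B A := by
  simp [frobInner_eq_sum, mul_comm]

theorem frobInner_add_left (A B C : Matrix ι κ ℝ) :
    frobInner (A + B) C = frobInner A C + frobInner B C := by
  simp [frobInner, Matrix.add_mul]

theorem frobInner_add_right (A B C : Matrix ι κ ℝ) :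
    frobInner A (B + C) = frobInner A B + frobInner A C := by
  simp [frobInner, Matrix.mul_add]

theorem frobInner_sub_left (A B C : Matrix ι κ ℝ) :
    frobInner (A - B) C = frobInner A C - frobInner B C := by
  simp [frobInner, Matrix.sub_mul]

theorem frobInner_sub_right (A B C : Matrix ι κ ℝ) :
    frobInner A (B - C) = frobInner A B - frobInner A C := by
  simp [frobInner, Matrix.mul_sub]

theorem frobInner_sub_self (A B : Matrix ι κ ℝ) :
    frobInner (A - B) (A - B) = frobInner A A - 2 * frobInner A B + frobInner B B := by
  rw [frobInner_sub_left, frobInner_sub_right, frobInner_sub_right, frobInner_comm B A]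
  ring

theorem frobInner_add_self (A B : Matrix ι κ ℝ) :
    frobInner (A + B) (A + B) = frobInner A A + 2 * frobInner A B + frobInner B B := by
  rw [frobInner_add_left, frobInner_add_right, frobInner_add_right, frobInner_comm B A]
  ring

theorem frobInner_smul_left (t : ℝ) (A B : Matrix ι κ ℝ) :
    frobInner (t • A) B = t * frobInner A B := by
  simp [frobInner]

theorem frobInner_smul_right (t : ℝ) (A B : Matrix ι κ ℝ) :
    frobInner A (t • B) = t * frobInner A B := by
  simp [frobInner]

theorem frobInner_transpose (A B : Matrix ι κ ℝ) : frobInner Aᵀ Bᵀ = frobInner A B := by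
  rw [frobInner_eq_sum, frobInner_eq_sum, Finset.sum_comm]; rfl

theorem frobInner_mul_left (A : Matrix ι μ ℝ) (B : Matrix μ κ ℝ) (C : Matrix ι κ ℝ) :
    frobInner (A * B) C = frobInner B (Aᵀ * C) := by
  simp [frobInner, Matrix.mul_assoc]

theorem frobInner_mul_right (A : Matrix ι μ ℝ) (B : Matrix μ κ ℝ) (C : Matrix ι κ ℝ) :
    frobInner (A * B) C = frobInner A (C * Bᵀ) := by
  rw [frobInner, frobInner, transpose_mul, Matrix.mul_assoc, trace_mul_comm, Matrix.mul_assoc]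

theorem frobInner_self_nonneg (A : Matrix ι κ ℝ) : 0 ≤ frobInner A A := by
  rw [frobInner_eq_sum]
  exact Finset.sum_nonneg fun _ _ => Finset.sum_nonneg fun _ _ => mul_self_nonneg _

theorem frobInner_self_eq_zero {A : Matrix ι κ ℝ} : frobInner A A = 0 ↔ A = 0 := by
  refine ⟨fun h => ?_, fun h => by simp [h, frobInner]⟩
  rw [frobInner_eq_sum, Finset.sum_eq_zero_iff_of_nonneg
    fun _ _ => Finset.sum_nonneg fun _ _ => mul_self_nonneg _] at h
  ext i j
  have hj := h j (Finset.mem_univ j)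
  rw [Finset.sum_eq_zero_iff_of_nonneg fun _ _ => mul_self_nonneg _] at hj
  exact mul_self_eq_zero.mp (hj i (Finset.mem_univ i))

theorem frobInner_self_eq_sum_col (A : Matrix ι κ ℝ) :
    frobInner A A = ∑ j, frobInner (A.submatrix id fun _ : Fin 1 => j)
      (A.submatrix id fun _ : Fin 1 => j) := by
  simp [frobInner_eq_sum]

theorem frobInner_col_mul_row (u : Matrix ι (Fin 1) ℝ) (c : Matrix (Fin 1) κ ℝ) :
    frobInner (u * c) (u * c) = frobInner c c * frobInner u u := by
  simp only [frobInner_eq_sum, mul_apply, Fin.sum_univ_one, Finset.sum_mul_sum]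
  exact Finset.sum_congr rfl fun _ _ => Finset.sum_congr rfl fun _ _ => by ring

theorem frobInner_self_of_transpose_mul_eq_one [DecidableEq κ] {A : Matrix ι κ ℝ}
    (hA : Aᵀ * A = 1) : frobInner A A = Fintype.card κ := by
  simp [frobInner, hA]

theorem frobInner_isometry_mul [DecidableEq μ] {A : Matrix ι μ ℝ} (hA : Aᵀ * A = 1)
    (B C : Matrix μ κ ℝ) : frobInner (A * B) (A * C) = frobInner B C := by
  rw [frobInner_mul_left, ← Matrix.mul_assoc, hA, Matrix.one_mul]

end frobInner

theorem exists_right_inverse_of_rank_eq {m n : ℕ} {A : Matrix (Fin m) (Fin n) ℝ}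
    (hA : A.rank = m) : ∃ R : Matrix (Fin n) (Fin m) ℝ, A * R = 1 := by
  rw [← mulVec_surjective_iff_exists_right_inverse]
  have : LinearMap.range A.mulVecLin = ⊤ := by
    apply Submodule.eq_top_of_finrank_eq
    rw [← Matrix.rank, hA]; simp
  exact LinearMap.range_eq_top.mp this

theorem exists_left_inverse_of_rank_eq {m n : ℕ} {A : Matrix (Fin m) (Fin n) ℝ}
    (hA : A.rank = n) : ∃ L : Matrix (Fin n) (Fin m) ℝ, L * A = 1 := by
  obtain ⟨R, hR⟩ := exists_right_inverse_of_rank_eq (A := Aᵀ) (by rw [rank_transpose, hA])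
  exact ⟨Rᵀ, by rw [← transpose_transpose A, ← transpose_mul, hR, transpose_one]⟩

/-- Orthonormalization of the column space: `A = O Oᵀ A` with `O` an isometry whose columns lie
in the column space of `A`. -/
theorem exists_orthonormal_factor {m p : ℕ} (A : Matrix (Fin m) (Fin p) ℝ) :
    ∃ (O : Matrix (Fin m) (Fin A.rank) ℝ) (N : Matrix (Fin p) (Fin A.rank) ℝ),
      Oᵀ * O = 1 ∧ O = A * N ∧ O * (Oᵀ * A) = A := by
  let K := LinearMap.range (Matrix.toEuclideanLin A)
  have hK : Module.finrank ℝ K = A.rank := by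
    rw [rank_eq_finrank_range_toLin A (EuclideanSpace.basisFun _ ℝ).toBasis
      (EuclideanSpace.basisFun _ ℝ).toBasis]
    simp only [K, toEuclideanLin_eq_toLin_orthonormal]
    rfl
  let b := (stdOrthonormalBasis ℝ K).reindex (finCongr hK)
  have hb : ∀ j, ∃ v, Matrix.toEuclideanLin A v = (b j : EuclideanSpace ℝ (Fin m)) :=
    fun j => (b j).2
  choose v hv using hb
  refine ⟨of fun i j => (b j : EuclideanSpace ℝ (Fin m)) i, of fun i j => v j i, ?_, ?_, ?_⟩
  · ext i j
    have := orthonormal_iff_ite.mp b.orthonormal i j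
    rw [Submodule.coe_inner, PiLp.inner_apply] at this
    simp only [mul_apply, transpose_apply, of_apply, one_apply, ← this]
    exact Finset.sum_congr rfl fun k _ => by simp [mul_comm]
  · ext i j
    simp only [of_apply, ← hv, mul_apply]
    simp [toEuclideanLin, mulVec, dotProduct]
  · ext i c
    let a : K := ⟨Matrix.toEuclideanLin A (EuclideanSpace.single c 1), ⟨_, rfl⟩⟩
    have ha : ∀ i, (a : EuclideanSpace ℝ (Fin m)) i = A i c := by
      intro i; simp [a, toEuclideanLin]
    have := congrArg (fun x : K => (x : EuclideanSpace ℝ (Fin m)) i) (b.sum_repr' a)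
    simp only [ha] at this
    rw [← this]
    simp only [mul_apply, transpose_apply, of_apply]
    simp [Submodule.coe_inner, PiLp.inner_apply, ha, mul_comm]

theorem exists_least_squares {d m n : ℕ} (X : Matrix (Fin d) (Fin n) ℝ)
    (Y : Matrix (Fin m) (Fin n) ℝ) : ∃ N : Matrix (Fin m) (Fin d) ℝ, (Y - N * X) * Xᵀ = 0 := by
  obtain ⟨O, N, -, hN, hX⟩ := exists_orthonormal_factor Xᵀ
  refine ⟨Y * O * Nᵀ, ?_⟩
  have h1 : Nᵀ * X = Oᵀ := by rw [hN, transpose_mul, transpose_transpose]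
  rw [Matrix.mul_assoc _ Nᵀ, h1, Matrix.sub_mul, Matrix.mul_assoc, Matrix.mul_assoc, hX, sub_self]

theorem _root_.LinearMap.exists_unit_forall_norm_le {E F : Type*} [NormedAddCommGroup E]
    [NormedSpace ℝ E] [FiniteDimensional ℝ E] [Nontrivial E] [NormedAddCommGroup F]
    [NormedSpace ℝ F] (L : E →ₗ[ℝ] F) : ∃ z : E, ‖z‖ = 1 ∧ ∀ w, ‖L z‖ * ‖w‖ ≤ ‖L w‖ := by
  have hc : Continuous fun z => ‖L z‖ := L.continuous_of_finiteDimensional.norm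
  have := FiniteDimensional.proper_real E
  obtain ⟨z, hz, hmin⟩ := (isCompact_sphere (0 : E) 1).exists_isMinOn
    (NormedSpace.sphere_nonempty.mpr zero_le_one) hc.continuousOn
  refine ⟨z, by simpa using hz, fun w => ?_⟩
  rcases eq_or_ne w 0 with rfl | hw
  · simp
  have hw' : 0 < ‖w‖ := norm_pos_iff.mpr hw
  have := hmin (show ‖w‖⁻¹ • w ∈ Metric.sphere (0 : E) 1 by simp [norm_smul, hw'.ne'])
  simp only [Set.mem_ofPred_eq, map_smul, norm_smul, norm_inv, norm_norm] at this
  rwa [inv_mul_eq_div, le_div_iff₀ hw'] at this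

/-- The least value of `‖zᵀ C‖²` over unit vectors `z` is attained. -/
theorem exists_unit_forall_frobInner_le {p n : ℕ} (hp : 0 < p) (C : Matrix (Fin p) (Fin n) ℝ) :
    ∃ z : Matrix (Fin p) (Fin 1) ℝ, zᵀ * z = 1 ∧
      ∀ {m : ℕ} (F : Matrix (Fin m) (Fin p) ℝ),
        frobInner (zᵀ * C) (zᵀ * C) * frobInner F F ≤ frobInner (F * C) (F * C) := by
  have : NeZero p := ⟨hp.ne'⟩
  have hrow : ∀ {m q : ℕ} (G : Matrix (Fin m) (Fin q) ℝ),
      frobInner G G = ∑ i, ‖WithLp.toLp 2 (G i)‖ ^ 2 := by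
    intro m q G
    rw [frobInner_eq_sum, Finset.sum_comm]
    refine Finset.sum_congr rfl fun i _ => ?_
    rw [EuclideanSpace.norm_sq_eq]
    simp [pow_two]
  let L := toEuclideanLin Cᵀ
  have hL : ∀ {m : ℕ} (F : Matrix (Fin m) (Fin p) ℝ) i,
      WithLp.toLp 2 ((F * C) i) = L (WithLp.toLp 2 (F i)) := by
    intro m F i
    ext j
    simp [L, toEuclideanLin, mul_apply, mulVec, dotProduct, mul_comm]
  obtain ⟨z, hz, hmin⟩ := L.exists_unit_forall_norm_le
  refine ⟨of fun i _ => z i, ?_, fun F => ?_⟩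
  · have h2 : ‖z‖ ^ 2 = 1 := by rw [hz, one_pow]
    rw [EuclideanSpace.norm_sq_eq] at h2
    ext i j
    rw [Subsingleton.elim i j, one_apply_eq]
    simpa [mul_apply, pow_two] using h2
  · have h1 : WithLp.toLp 2 ((of fun i (_ : Fin 1) => z i : Matrix _ _ ℝ)ᵀ 0) = z := rfl
    rw [hrow, hrow F, hrow (F * C)]
    simp only [hL, Fin.sum_univ_one, h1, Finset.mul_sum]
    refine Finset.sum_le_sum fun i _ => ?_
    rw [← mul_pow]
    exact pow_le_pow_left₀ (by positivity) (hmin _) 2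

/-- Second-order stationary points `(A, B)` of `‖A B X - Y‖²` with `A` an isometry minimize it
globally. -/
theorem frobInner_le_of_second_order_of_isometry {m p d n : ℕ} (hp : 0 < p)
    {A : Matrix (Fin m) (Fin p) ℝ} (hA : Aᵀ * A = 1) (B : Matrix (Fin p) (Fin d) ℝ)
    (X : Matrix (Fin d) (Fin n) ℝ) (Y : Matrix (Fin m) (Fin n) ℝ)
    (h1 : ∀ (U : Matrix (Fin m) (Fin p) ℝ) (V : Matrix (Fin p) (Fin d) ℝ),
      frobInner (A * B * X - Y) ((U * B + A * V) * X) = 0)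
    (h2 : ∀ (U : Matrix (Fin m) (Fin p) ℝ) (V : Matrix (Fin p) (Fin d) ℝ),
      0 ≤ frobInner ((U * B + A * V) * X) ((U * B + A * V) * X) +
        2 * frobInner (A * B * X - Y) (U * V * X))
    (A' : Matrix (Fin m) (Fin p) ℝ) (B' : Matrix (Fin p) (Fin d) ℝ) :
    frobInner (A * B * X - Y) (A * B * X - Y) ≤ frobInner (A' * B' * X - Y) (A' * B' * X - Y) := by
  obtain ⟨N, hN⟩ := exists_least_squares X Y
  obtain ⟨O, -, hO, -, hOA⟩ := exists_orthonormal_factor A'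
  have hk := rank_le_width A'
  generalize A'.rank = k at *
  set C := B * X with hC
  set R := (N - A * B) * X with hR
  have horth : ∀ M : Matrix (Fin m) (Fin d) ℝ, frobInner (Y - N * X) (M * X) = 0 := by
    intro M
    rw [frobInner_comm, frobInner_mul_right, hN]; simp [frobInner]
  have hE : ∀ M : Matrix (Fin m) (Fin d) ℝ,
      frobInner (A * B * X - Y) (M * X) = - frobInner R (M * X) := by
    intro M
    have : A * B * X - Y = -1 • R - (Y - N * X) := by
      rw [hR, Matrix.sub_mul]; simp
    rw [this, frobInner_sub_left, horth]
    simp [frobInner]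
  have hpyth : ∀ M : Matrix (Fin m) (Fin d) ℝ, frobInner (M * X - Y) (M * X - Y) =
      frobInner (M * X - N * X) (M * X - N * X) + frobInner (Y - N * X) (Y - N * X) := by
    intro M
    have h0 := horth (M - N)
    have : M * X - Y = (M - N) * X - (Y - N * X) := by rw [Matrix.sub_mul]; abel
    rw [this, ← Matrix.sub_mul, frobInner_sub_self, frobInner_comm _ (Y - N * X), h0]
    ring
  have hRC : R * Cᵀ = 0 := by
    have := h1 (R * Cᵀ) 0
    rw [hE, Matrix.mul_zero, add_zero, Matrix.mul_assoc _ B, ← hC, frobInner_comm,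
      frobInner_mul_right, neg_eq_zero] at this
    exact frobInner_self_eq_zero.mp this
  have hAR : Aᵀ * R = 0 := by
    have := h1 0 (Aᵀ * (N - A * B))
    rw [hE, Matrix.zero_mul, zero_add, Matrix.mul_assoc, Matrix.mul_assoc, ← hR, frobInner_comm,
      frobInner_mul_left, neg_eq_zero] at this
    exact frobInner_self_eq_zero.mp this
  obtain ⟨z, hz, hmin⟩ := exists_unit_forall_frobInner_le hp C
  set l := frobInner (zᵀ * C) (zᵀ * C) with hl
  have hl0 : 0 ≤ l := frobInner_self_nonneg _
  have hcol : ∀ u : Matrix (Fin m) (Fin 1) ℝ, Aᵀ * u = 0 →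
      frobInner (Rᵀ * u) (Rᵀ * u) ≤ l * frobInner u u := by
    intro u hu
    set w := uᵀ * R with hw
    have hwt : Rᵀ * u = wᵀ := by rw [hw, transpose_mul uᵀ R, transpose_transpose]
    have hz' : ∀ {κ : Type} [Fintype κ] (G : Matrix (Fin 1) κ ℝ), zᵀ * (z * G) = G := by
      intro κ _ G
      rw [← Matrix.mul_assoc, hz, Matrix.one_mul]
    have key := h2 (u * zᵀ) (z * (uᵀ * (N - A * B)))
    have e1 : (u * zᵀ * B + A * (z * (uᵀ * (N - A * B)))) * X = u * (zᵀ * C) + A * (z * w) := by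
      simp only [hC, hw, hR, Matrix.add_mul, Matrix.mul_assoc]
    have e2 : u * zᵀ * (z * (uᵀ * (N - A * B))) = u * (uᵀ * (N - A * B)) := by
      rw [Matrix.mul_assoc, hz']
    have e3 : frobInner R (u * (uᵀ * (N - A * B)) * X) = frobInner w w := by
      rw [Matrix.mul_assoc, Matrix.mul_assoc, ← hR, ← hw, frobInner_comm, frobInner_mul_left]
    have e4 : frobInner (A * (z * w)) (u * (zᵀ * C)) = 0 := by
      rw [frobInner_mul_left, ← Matrix.mul_assoc Aᵀ, hu]; simp [frobInner]
    have e5 : frobInner (A * (z * w)) (A * (z * w)) = frobInner w w := by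
      rw [frobInner_isometry_mul hA, frobInner_mul_left, hz']
    have e6 : frobInner (u * (zᵀ * C)) (u * (zᵀ * C)) = l * frobInner u u := by
      rw [hl, frobInner_col_mul_row]
    rw [e1, e2, hE, e3, frobInner_add_self,
      frobInner_comm (u * (zᵀ * C)) (A * (z * w)), e4, e5, e6] at key
    rw [hwt, frobInner_transpose]
    linarith
  have hD : ∀ D : Matrix (Fin m) (Fin k) ℝ, Aᵀ * D = 0 →
      frobInner (Rᵀ * D) (Rᵀ * D) ≤ l * frobInner D D := by
    intro D hD
    rw [frobInner_self_eq_sum_col, frobInner_self_eq_sum_col D, Finset.mul_sum]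
    refine Finset.sum_le_sum fun j _ => ?_
    refine hcol (D.submatrix id fun _ => j) ?_
    ext a b
    simpa [mul_apply] using congrFun (congrFun hD a) j
  set G := Aᵀ * O with hG
  have hR_le : frobInner (Oᵀ * R) (Oᵀ * R) ≤ l * (k - frobInner G G) := by
    have := hD (O - A * G) (by
      rw [Matrix.mul_sub, ← Matrix.mul_assoc, hA, Matrix.one_mul, sub_self])
    have e1 : Rᵀ * (O - A * G) = (Oᵀ * R)ᵀ := by
      have : Rᵀ * A = 0 := by rw [← transpose_transpose A, ← transpose_mul, hAR, transpose_zero]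
      rw [Matrix.mul_sub, ← Matrix.mul_assoc, this, Matrix.zero_mul, sub_zero,
        transpose_mul Oᵀ R, transpose_transpose]
    have e2 : frobInner (O - A * G) (O - A * G) = k - frobInner G G := by
      rw [frobInner_sub_self, frobInner_isometry_mul hA, frobInner_comm O (A * G),
        frobInner_mul_left A G O, ← hG, frobInner_self_of_transpose_mul_eq_one hO, Fintype.card_fin]
      ring
    rwa [e1, e2, frobInner_transpose] at this
  have hC_le : l * (p - frobInner G G) ≤
      frobInner C C - frobInner (Oᵀ * (A * C)) (Oᵀ * (A * C)) := by
    have := hmin (A - O * Gᵀ)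
    have hGt : Oᵀ * A = Gᵀ := by rw [hG, transpose_mul, transpose_transpose]
    have e1 : frobInner (A - O * Gᵀ) (A - O * Gᵀ) = p - frobInner G G := by
      rw [frobInner_sub_self, frobInner_isometry_mul hO, frobInner_comm A (O * Gᵀ),
        frobInner_mul_left O Gᵀ A, hGt, frobInner_self_of_transpose_mul_eq_one hA,
        frobInner_transpose, Fintype.card_fin]
      ring
    have e2 : frobInner ((A - O * Gᵀ) * C) ((A - O * Gᵀ) * C) =
        frobInner C C - frobInner (Oᵀ * (A * C)) (Oᵀ * (A * C)) := by
      rw [Matrix.sub_mul, Matrix.mul_assoc, frobInner_sub_self, frobInner_isometry_mul hO,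
        frobInner_isometry_mul hA, frobInner_comm (A * C) (O * (Gᵀ * C)),
        frobInner_mul_left O (Gᵀ * C) (A * C), ← Matrix.mul_assoc Oᵀ A C, hGt]
      ring
    rwa [e1, e2] at this
  have hY1 : N * X = A * C + R := by
    rw [hR, hC, Matrix.sub_mul, Matrix.mul_assoc]; abel
  have hcross : frobInner (A * C) R = 0 := by rw [frobInner_mul_left, hAR]; simp [frobInner]
  have hproj : frobInner (Oᵀ * (N * X)) (Oᵀ * (N * X)) =
      frobInner (Oᵀ * (A * C)) (Oᵀ * (A * C)) + frobInner (Oᵀ * R) (Oᵀ * R) := by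
    have : frobInner (Oᵀ * (A * C)) (Oᵀ * R) = 0 := by
      rw [← Matrix.mul_assoc, frobInner_mul_right, Matrix.mul_assoc, hRC]; simp [frobInner]
    rw [hY1, Matrix.mul_add, frobInner_add_self, this]
    ring
  have hY1sq : frobInner (N * X) (N * X) = frobInner C C + frobInner R R := by
    rw [hY1, frobInner_add_self, hcross, frobInner_isometry_mul hA]
    ring
  have hle : frobInner (Oᵀ * (N * X)) (Oᵀ * (N * X)) ≤ frobInner C C := by
    have hkp : (k : ℝ) ≤ p := by exact_mod_cast hk
    nlinarith [mul_le_mul_of_nonneg_left hkp hl0]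
  rw [hpyth, hpyth (A' * B')]
  gcongr
  have hleft : A * B * X - N * X = -1 • R := by rw [hR, Matrix.sub_mul]; simp
  set Z := A' * B' * X with hZ
  have hZO : Z = O * (Oᵀ * Z) := by
    rw [hZ, ← hOA]
    simp only [Matrix.mul_assoc]
    rw [← Matrix.mul_assoc Oᵀ O, hO, Matrix.one_mul]
  have hfin := frobInner_self_nonneg (Oᵀ * Z - Oᵀ * (N * X))
  have hZZ : frobInner Z Z = frobInner (Oᵀ * Z) (Oᵀ * Z) := by
    conv_lhs => rw [hZO]
    rw [frobInner_isometry_mul hO]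
  have hZY : frobInner Z (N * X) = frobInner (Oᵀ * Z) (Oᵀ * (N * X)) := by
    conv_lhs => rw [hZO]
    rw [frobInner_mul_left]
  have hRR : frobInner (-1 • R) (-1 • R) = frobInner R R := by simp [frobInner]
  rw [hleft, hRR, frobInner_sub_self]
  rw [frobInner_sub_self] at hfin
  linarith

theorem frobInner_le_of_second_order {m p d n : ℕ} (hp : 0 < p)
    {A : Matrix (Fin m) (Fin p) ℝ} (hA : A.rank = p) (B : Matrix (Fin p) (Fin d) ℝ)
    (X : Matrix (Fin d) (Fin n) ℝ) (Y : Matrix (Fin m) (Fin n) ℝ)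
    (h1 : ∀ (U : Matrix (Fin m) (Fin p) ℝ) (V : Matrix (Fin p) (Fin d) ℝ),
      frobInner (A * B * X - Y) ((U * B + A * V) * X) = 0)
    (h2 : ∀ (U : Matrix (Fin m) (Fin p) ℝ) (V : Matrix (Fin p) (Fin d) ℝ),
      0 ≤ frobInner ((U * B + A * V) * X) ((U * B + A * V) * X) +
        2 * frobInner (A * B * X - Y) (U * V * X))
    (A' : Matrix (Fin m) (Fin p) ℝ) (B' : Matrix (Fin p) (Fin d) ℝ) :
    frobInner (A * B * X - Y) (A * B * X - Y) ≤ frobInner (A' * B' * X - Y) (A' * B' * X - Y) := by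
  obtain ⟨O, N, hO, hN, hOA⟩ := exists_orthonormal_factor A
  generalize A.rank = k at *
  subst hA
  set T := Oᵀ * A with hT
  have hNT : N * T = 1 := mul_eq_one_comm.mp (by rw [hT, Matrix.mul_assoc, ← hN, hO])
  have hAB : A * B = O * (T * B) := by rw [← Matrix.mul_assoc, hOA]
  have hsum : ∀ (U : Matrix (Fin m) (Fin k) ℝ) (V : Matrix (Fin k) (Fin d) ℝ),
      U * (T * B) + O * V = U * T * B + A * (N * V) := by
    intro U V
    rw [← Matrix.mul_assoc, ← Matrix.mul_assoc A, ← hN]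
  have hprod : ∀ (U : Matrix (Fin m) (Fin k) ℝ) (V : Matrix (Fin k) (Fin d) ℝ),
      U * V = U * T * (N * V) := by
    intro U V
    rw [Matrix.mul_assoc, ← Matrix.mul_assoc T, mul_eq_one_comm.mp hNT, Matrix.one_mul]
  rw [hAB]
  refine frobInner_le_of_second_order_of_isometry hp hO (T * B) X Y (fun U V => ?_)
    (fun U V => ?_) A' B'
  · rw [hsum U V, ← hAB]
    exact h1 _ _
  · rw [hsum U V, hprod U V, ← hAB]
    exact h2 _ _

/-- If a path `E + t F + t² H` has minimal norm at `t = 0` locally, then the first and second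
order necessary conditions hold. -/
theorem frobInner_necessary_conditions {m n : ℕ} {E F H : Matrix (Fin m) (Fin n) ℝ} {δ : ℝ}
    (hδ : 0 < δ) (hmin : ∀ t : ℝ, |t| < δ →
      frobInner E E ≤ frobInner (E + t • F + t ^ 2 • H) (E + t • F + t ^ 2 • H)) :
    frobInner E F = 0 ∧ 0 ≤ frobInner F F + 2 * frobInner E H := by
  have hlim : ∀ g : ℝ → ℝ, Continuous g → (∀ t, 0 < t → t < δ → 0 ≤ g t) → 0 ≤ g 0 := by
    intro g hg h
    refine ge_of_tendsto (hg.continuousWithinAt (s := Set.Ioi 0) (x := 0)) ?_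
    filter_upwards [Ioo_mem_nhdsGT hδ] with t ht using h t ht.1 ht.2
  set a := frobInner E F with ha
  set b := frobInner F F + 2 * frobInner E H with hb
  set c := frobInner F H with hc
  set e := frobInner H H with he
  have hexp : ∀ t : ℝ, |t| < δ → 0 ≤ t * (2 * a + t * (b + t * (2 * c + t * e))) := by
    intro t ht
    have := hmin t ht
    simp only [frobInner_add_left, frobInner_add_right, frobInner_smul_left, frobInner_smul_right,
      frobInner_comm F E, frobInner_comm H E, frobInner_comm H F] at this
    nlinarith
  have h1 : 0 ≤ a := by
    have := hlim (fun t => 2 * a + t * (b + t * (2 * c + t * e))) (by fun_prop) fun t h0 h1 =>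
      nonneg_of_mul_nonneg_right (hexp t (by rwa [abs_of_pos h0])) h0
    linarith
  have h2 : a ≤ 0 := by
    have := hlim (fun t => -(2 * a + -t * (b + -t * (2 * c + -t * e)))) (by fun_prop) fun t h0 h1 =>
      nonneg_of_mul_nonneg_right
        (by linarith [hexp (-t) (by rwa [abs_neg, abs_of_pos h0])]) h0
    linarith
  have h3 : a = 0 := le_antisymm h2 h1
  refine ⟨h3, ?_⟩
  have := hlim (fun t => b + t * (2 * c + t * e)) (by fun_prop) fun t h0 h1 => by
    have := hexp t (by rwa [abs_of_pos h0])
    rw [h3, mul_zero, zero_add] at this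
    exact nonneg_of_mul_nonneg_right (nonneg_of_mul_nonneg_right this h0) h0
  simpa using this

end Matrix

section chainProd

variable {d : ℕ → ℕ}

theorem frob_sq {m n : ℕ} (A : Matrix (Fin m) (Fin n) ℝ) : frob A ^ 2 = frobInner A A := by
  rw [frob, Real.sq_sqrt (show 0 ≤ ∑ i, ∑ j, A i j ^ 2 by positivity), frobInner_eq_sum,
    Finset.sum_comm]
  simp only [pow_two]

theorem frob_nonneg {m n : ℕ} (A : Matrix (Fin m) (Fin n) ℝ) : 0 ≤ frob A := Real.sqrt_nonneg _

theorem frob_smul {m n : ℕ} (t : ℝ) (A : Matrix (Fin m) (Fin n) ℝ) :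
    frob (t • A) = |t| * frob A := by
  rw [← sq_eq_sq₀ (frob_nonneg _) (mul_nonneg (abs_nonneg _) (frob_nonneg _)), mul_pow, frob_sq,
    frob_sq, frobInner_smul_left, frobInner_smul_right, sq_abs]
  ring

theorem exists_pos_forall_frob_smul_lt (h : ℕ)
    (D : (i : ℕ) → Matrix (Fin (d (i + 1))) (Fin (d i)) ℝ) {ε : ℝ} (hε : 0 < ε) :
    ∃ δ > 0, ∀ t : ℝ, |t| < δ → ∀ i < h, frob (t • D i) < ε := by
  set S := ∑ i ∈ Finset.range h, frob (D i) with hS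
  have hS0 : 0 ≤ S := Finset.sum_nonneg fun _ _ => frob_nonneg _
  refine ⟨ε / (S + 1), by positivity, fun t ht i hi => ?_⟩
  rw [lt_div_iff₀ (by positivity)] at ht
  have hle : frob (D i) ≤ S :=
    Finset.single_le_sum (f := fun i => frob (D i)) (fun _ _ => frob_nonneg _)
      (Finset.mem_range.mpr hi)
  rw [frob_smul]
  nlinarith [mul_le_mul_of_nonneg_left hle (abs_nonneg t), abs_nonneg t]

/-- The product `W_{k+q-1} ⋯ W_k` of `q` consecutive layers starting at layer `k`. -/
noncomputable def tailProd (d : ℕ → ℕ)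
    (W : (i : ℕ) → Matrix (Fin (d (i + 1))) (Fin (d i)) ℝ) (k : ℕ) :
    (q : ℕ) → Matrix (Fin (d (k + q))) (Fin (d k)) ℝ
  | 0 => 1
  | (q + 1) => W (k + q) * tailProd d W k q

theorem chainProd_add (W : (i : ℕ) → Matrix (Fin (d (i + 1))) (Fin (d i)) ℝ) (k q : ℕ) :
    chainProd d W (k + q) = tailProd d W k q * chainProd d W k := by
  induction q with
  | zero => exact (Matrix.one_mul _).symm
  | succ q ih =>
    change W (k + q) * chainProd d W (k + q) = W (k + q) * tailProd d W k q * chainProd d W k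
    rw [ih, Matrix.mul_assoc]

theorem chainProd_one_add (W : (i : ℕ) → Matrix (Fin (d (i + 1))) (Fin (d i)) ℝ) (r : ℕ) :
    chainProd d W (1 + r) = tailProd d W 1 r * W 0 := by
  rw [chainProd_add]
  congr 1
  exact Matrix.mul_one _

theorem chainProd_congr {W W' : (i : ℕ) → Matrix (Fin (d (i + 1))) (Fin (d i)) ℝ} {k : ℕ}
    (hW : ∀ i < k, W i = W' i) : chainProd d W k = chainProd d W' k := by
  induction k with
  | zero => rfl
  | succ k ih =>
    rw [chainProd, chainProd, hW k k.lt_succ_self, ih fun i hi => hW i (hi.trans k.lt_succ_self)]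

theorem tailProd_congr {W W' : (i : ℕ) → Matrix (Fin (d (i + 1))) (Fin (d i)) ℝ} {k q : ℕ}
    (hW : ∀ i, k ≤ i → i < k + q → W i = W' i) : tailProd d W k q = tailProd d W' k q := by
  induction q with
  | zero => rfl
  | succ q ih =>
    rw [tailProd, tailProd, hW (k + q) (by omega) (by omega),
      ih fun i hi hi' => hW i hi (by omega)]

end chainProd

/-- Local minimality along every line forces global minimality for linear least squares. -/
theorem frobInner_le_of_local_min_on_lines {m d n : ℕ} {M : Matrix (Fin m) (Fin d) ℝ}
    {X : Matrix (Fin d) (Fin n) ℝ} {Y : Matrix (Fin m) (Fin n) ℝ}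
    (hmin : ∀ U : Matrix (Fin m) (Fin d) ℝ, ∃ δ > 0, ∀ t : ℝ, |t| < δ →
      frobInner (M * X - Y) (M * X - Y) ≤
        frobInner ((M + t • U) * X - Y) ((M + t • U) * X - Y))
    (M' : Matrix (Fin m) (Fin d) ℝ) :
    frobInner (M * X - Y) (M * X - Y) ≤ frobInner (M' * X - Y) (M' * X - Y) := by
  obtain ⟨δ, hδ, hU⟩ := hmin (M' - M)
  have h0 := (frobInner_necessary_conditions (E := M * X - Y) (F := (M' - M) * X) (H := 0) hδ
    fun t ht => by
      convert hU t ht using 2 <;>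
      · rw [Matrix.add_mul, Matrix.smul_mul, smul_zero, add_zero]; abel).1
  have : M' * X - Y = M * X - Y + (M' - M) * X := by rw [Matrix.sub_mul]; abel
  rw [this, frobInner_add_self, h0]
  linarith [frobInner_self_nonneg ((M' - M) * X)]

/-- A local minimum (along lines) of `‖A B X - Y‖²` with `A` of full column rank is global. -/
theorem frobInner_le_of_local_min_of_factors {m p d n : ℕ} (hp : 0 < p)
    {A : Matrix (Fin m) (Fin p) ℝ} (hA : A.rank = p) {B : Matrix (Fin p) (Fin d) ℝ}
    {X : Matrix (Fin d) (Fin n) ℝ} {Y : Matrix (Fin m) (Fin n) ℝ}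
    (hmin : ∀ (U : Matrix (Fin m) (Fin p) ℝ) (V : Matrix (Fin p) (Fin d) ℝ),
      ∃ δ > 0, ∀ t : ℝ, |t| < δ → frobInner (A * B * X - Y) (A * B * X - Y) ≤
        frobInner ((A + t • U) * (B + t • V) * X - Y) ((A + t • U) * (B + t • V) * X - Y))
    (A' : Matrix (Fin m) (Fin p) ℝ) (B' : Matrix (Fin p) (Fin d) ℝ) :
    frobInner (A * B * X - Y) (A * B * X - Y) ≤
      frobInner (A' * B' * X - Y) (A' * B' * X - Y) := by
  have key : ∀ (U : Matrix (Fin m) (Fin p) ℝ) (V : Matrix (Fin p) (Fin d) ℝ),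
      frobInner (A * B * X - Y) ((U * B + A * V) * X) = 0 ∧
      0 ≤ frobInner ((U * B + A * V) * X) ((U * B + A * V) * X) +
        2 * frobInner (A * B * X - Y) (U * V * X) := by
    intro U V
    obtain ⟨δ, hδ, hUV⟩ := hmin U V
    refine frobInner_necessary_conditions hδ fun t ht => ?_
    have hexp : (A + t • U) * (B + t • V) * X - Y =
        A * B * X - Y + t • ((U * B + A * V) * X) + t ^ 2 • (U * V * X) := by
      simp only [Matrix.add_mul, Matrix.mul_add, Matrix.smul_mul, Matrix.mul_smul, smul_add,
        smul_smul, pow_two]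
      abel
    rw [← hexp]
    exact hUV t ht
  exact frobInner_le_of_second_order hp hA B X Y (fun U V => (key U V).1)
    (fun U V => (key U V).2) A' B'

/-- For arbitrary `X`, `Y`, every non-degenerate local minimum of the deep
linear network objective `f(W) = (1/2)·‖W_h ⋯ W_1·X − Y‖²` is a global minimum. -/
theorem statement_10 {n : ℕ} (h : ℕ) (hh : 1 ≤ h) (d : ℕ → ℕ)
    (X : Matrix (Fin (d 0)) (Fin n) ℝ) (Y : Matrix (Fin (d h)) (Fin n) ℝ)
    (W₀ : (i : ℕ) → Matrix (Fin (d (i + 1))) (Fin (d i)) ℝ)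
    (hnd : (chainProd d W₀ h).rank =
      (Finset.range (h + 1)).inf' (Finset.nonempty_range_iff.mpr (Nat.succ_ne_zero h)) d)
    (hloc : ∃ ε > 0, ∀ W : (i : ℕ) → Matrix (Fin (d (i + 1))) (Fin (d i)) ℝ,
      (∀ i < h, frob (W i - W₀ i) < ε) →
        (1 / 2) * frob (chainProd d W₀ h * X - Y) ^ 2 ≤
          (1 / 2) * frob (chainProd d W h * X - Y) ^ 2) :
    ∀ W : (i : ℕ) → Matrix (Fin (d (i + 1))) (Fin (d i)) ℝ,
      (1 / 2) * frob (chainProd d W₀ h * X - Y) ^ 2 ≤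
        (1 / 2) * frob (chainProd d W h * X - Y) ^ 2 := by
  simp only [frob_sq] at hloc ⊢
  have hmin : ∀ D : (i : ℕ) → Matrix (Fin (d (i + 1))) (Fin (d i)) ℝ, ∃ δ > 0, ∀ t : ℝ,
      |t| < δ → frobInner (chainProd d W₀ h * X - Y) (chainProd d W₀ h * X - Y) ≤
        frobInner (chainProd d (fun i => W₀ i + t • D i) h * X - Y)
          (chainProd d (fun i => W₀ i + t • D i) h * X - Y) := by
    intro D
    obtain ⟨ε, hε, hW⟩ := hloc
    obtain ⟨δ, hδ, hD⟩ := exists_pos_forall_frob_smul_lt h D hε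
    refine ⟨δ, hδ, fun t ht => ?_⟩
    have := hW (fun i => W₀ i + t • D i) fun i hi => by
      rw [add_sub_cancel_left]
      exact hD t ht i hi
    linarith
  clear hloc
  obtain ⟨k, hk, hdk⟩ := Finset.exists_mem_eq_inf' (Finset.nonempty_range_iff.mpr
    (Nat.succ_ne_zero h)) d
  rw [hdk] at hnd
  clear hdk
  rw [Finset.mem_range, Nat.lt_succ_iff] at hk
  intro W
  refine mul_le_mul_of_nonneg_left ?_ (by norm_num)
  rcases Nat.eq_zero_or_pos k with rfl | hk0
  · obtain ⟨q, rfl⟩ : ∃ q, h = q + 1 := ⟨h - 1, by omega⟩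
    have hrank : (chainProd d W₀ q).rank = d 0 :=
      le_antisymm (rank_le_width _) <| hnd.ge.trans <| by
      rw [chainProd]
      exact rank_mul_le_right _ _
    obtain ⟨L, hL⟩ := exists_left_inverse_of_rank_eq hrank
    refine frobInner_le_of_local_min_on_lines (fun U => ?_) _
    obtain ⟨D, hDq, hD0⟩ : ∃ D : (i : ℕ) → Matrix (Fin (d (i + 1))) (Fin (d i)) ℝ,
        D q = U * L ∧ ∀ i, i ≠ q → D i = 0 :=
      ⟨Function.update 0 q (U * L), Function.update_self .., fun i hi =>
        Function.update_of_ne hi ..⟩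
    obtain ⟨δ, hδ, hD⟩ := hmin D
    refine ⟨δ, hδ, fun t ht => ?_⟩
    have hq : chainProd d (fun i => W₀ i + t • D i) q = chainProd d W₀ q :=
      chainProd_congr fun i hi => by simp [hD0 i hi.ne]
    have hD' := hD t ht
    rw [chainProd, chainProd, hq, hDq, Matrix.add_mul, Matrix.smul_mul,
      Matrix.mul_assoc U, hL, Matrix.mul_one] at hD'
    exact hD'
  obtain ⟨r, rfl⟩ : ∃ r, k = 1 + r := ⟨k - 1, by omega⟩
  rcases hk.eq_or_lt with rfl | hlt
  · have hrank : (tailProd d W₀ 1 r).rank = d (1 + r) :=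
      le_antisymm (rank_le_height _) <| hnd.ge.trans <| by
      rw [chainProd_one_add]
      exact rank_mul_le_left _ _
    obtain ⟨R, hR⟩ := exists_right_inverse_of_rank_eq hrank
    refine frobInner_le_of_local_min_on_lines (fun U => ?_) _
    obtain ⟨D, hDr, hD0⟩ : ∃ D : (i : ℕ) → Matrix (Fin (d (i + 1))) (Fin (d i)) ℝ,
        D 0 = R * U ∧ ∀ i, i ≠ 0 → D i = 0 :=
      ⟨Function.update 0 0 (R * U), Function.update_self .., fun i hi =>
        Function.update_of_ne hi ..⟩
    obtain ⟨δ, hδ, hD⟩ := hmin D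
    refine ⟨δ, hδ, fun t ht => ?_⟩
    have hr : tailProd d (fun i => W₀ i + t • D i) 1 r = tailProd d W₀ 1 r :=
      tailProd_congr fun i hi _ => by simp [hD0 i (by omega)]
    have hD' := hD t ht
    rw [chainProd_one_add, chainProd_one_add, hr, hDr, Matrix.mul_add,
      Matrix.mul_smul, ← Matrix.mul_assoc _ R U, hR, Matrix.one_mul] at hD'
    rw [chainProd_one_add]
    exact hD'
  obtain ⟨q, rfl⟩ : ∃ q, h = 1 + r + (q + 1) := ⟨h - (1 + r) - 1, by omega⟩
  have hfac : ∀ V : (i : ℕ) → Matrix (Fin (d (i + 1))) (Fin (d i)) ℝ,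
      chainProd d V (1 + r + (q + 1)) =
        V (1 + r + q) * tailProd d V (1 + r) q * (tailProd d V 1 r * V 0) := by
    intro V
    rw [chainProd_add, chainProd_one_add, tailProd]
  rcases Nat.eq_zero_or_pos (d (1 + r)) with hp | hp
  · have : IsEmpty (Fin (d (1 + r))) := by rw [hp]; infer_instance
    have hzero : ∀ V, chainProd d V (1 + r + (q + 1)) = 0 := by
      intro V
      rw [hfac]
      ext i j
      simp [mul_apply (M := V (1 + r + q) * tailProd d V (1 + r) q)]
    rw [hzero, hzero W]
  have hA : (W₀ (1 + r + q) * tailProd d W₀ (1 + r) q).rank = d (1 + r) :=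
    le_antisymm (rank_le_width _) <| hnd.ge.trans <| by
      rw [hfac]
      exact rank_mul_le_left _ _
  have hT₂ : (tailProd d W₀ (1 + r) q).rank = d (1 + r) :=
    le_antisymm (rank_le_width _) <| hA.ge.trans (rank_mul_le_right _ _)
  have hT₁ : (tailProd d W₀ 1 r).rank = d (1 + r) :=
    le_antisymm (rank_le_height _) <| hnd.ge.trans <| by
      rw [hfac]
      exact (rank_mul_le_right _ _).trans (rank_mul_le_left _ _)
  obtain ⟨L, hL⟩ := exists_left_inverse_of_rank_eq hT₂
  obtain ⟨R, hR⟩ := exists_right_inverse_of_rank_eq hT₁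
  rw [hfac, hfac W]
  refine frobInner_le_of_local_min_of_factors hp hA (fun U V => ?_) _ _
  obtain ⟨D, hDq, hDr, hD0⟩ : ∃ D : (i : ℕ) → Matrix (Fin (d (i + 1))) (Fin (d i)) ℝ,
      D (1 + r + q) = U * L ∧ D 0 = R * V ∧ ∀ i, i ≠ 0 → i ≠ 1 + r + q → D i = 0 := by
    refine ⟨Function.update (Function.update 0 0 (R * V)) (1 + r + q) (U * L),
      Function.update_self .., ?_, fun i hi hi' => ?_⟩
    · rw [Function.update_of_ne (by omega), Function.update_self]
    · rw [Function.update_of_ne hi', Function.update_of_ne hi, Pi.zero_apply]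
  obtain ⟨δ, hδ, hD⟩ := hmin D
  refine ⟨δ, hδ, fun t ht => ?_⟩
  have h₂ : tailProd d (fun i => W₀ i + t • D i) (1 + r) q = tailProd d W₀ (1 + r) q :=
    tailProd_congr fun i hi hi' => by simp [hD0 i (by omega) (by omega)]
  have h₁ : tailProd d (fun i => W₀ i + t • D i) 1 r = tailProd d W₀ 1 r :=
    tailProd_congr fun i hi hi' => by simp [hD0 i (by omega) (by omega)]
  have hD' := hD t ht
  rw [hfac, hfac, h₁, h₂, hDq, hDr, Matrix.add_mul,
    Matrix.mul_add, Matrix.smul_mul, Matrix.mul_smul, Matrix.mul_assoc U, hL, Matrix.mul_one,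
    ← Matrix.mul_assoc _ R V, hR, Matrix.one_mul] at hD'
  exact hD'
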